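/- arXiv:math/0207001 — 4 statements merged into one kernel-verified Lean document; each statement's English description precedes it below -/
import Mathlib

section
/- Let k be a field, V and W finite-dimensional k-vector spaces, φ a nilpotent endomorphism of V, and ψ a nilpotent endomorphism of W. Then the endomorphism (1_V + φ)⊗(1_W + ψ) − 1_{V⊗W} of V ⊗_k W is similar to φ⊗1_W + 1_V⊗ψ. (Equivalently: the 'group-like' tensor operator given by the multiplicative formal group law u + v + uv, applied to φ⊗1 and 1⊗ψ, is similar to the 'Lie-algebra-like' tensor operator given by the additive law u + v.) -/
open TensorProduct

theorem DFinsupp.basis_apply {ι R : Type*} {M : ι → Type*} [DecidableEq ι] [Semiring R]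
    [∀ i, AddCommMonoid (M i)] [∀ i, Module R (M i)] {η : ι → Type*}
    (b : ∀ i, Module.Basis (η i) R (M i)) (s : Σ i, η i) :
    DFinsupp.basis b s = DFinsupp.single s.1 (b s.1 s.2) := by
  classical
  apply (DFinsupp.basis b).repr.injective
  rw [Module.Basis.repr_self]
  simp only [DFinsupp.basis, LinearEquiv.trans_apply, DFinsupp.mapRange.linearEquiv_apply,
    DFinsupp.mapRange_single, Module.Basis.repr_self]
  rw [LinearEquiv.eq_symm_apply]
  exact sigmaFinsuppEquivDFinsupp_single s 1

/-- In a quotient of `k[X]` by an ideal containing a power of `X`, the powers of `X` give a basis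
that multiplication by `X` shifts. -/
theorem exists_basis_quotient_X_smul {k : Type*} [Field k] (I : Ideal (Polynomial k)) (N : ℕ)
    (hI : Polynomial.X ^ N ∈ I) :
    ∃ (n : ℕ) (b : Module.Basis (Fin n) k (Polynomial k ⧸ I)), ∀ i,
      (Polynomial.X : Polynomial k) • b i = 0 ∨
        ∃ j : Fin n, (Polynomial.X : Polynomial k) • b i = b j ∧ (j : ℕ) = i + 1 := by
  obtain ⟨q, rfl⟩ := (IsPrincipalIdealRing.principal I).principal
  obtain ⟨m, -, hm⟩ :=
    (dvd_prime_pow Polynomial.prime_X N).1 (Ideal.mem_span_singleton.1 hI)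
  have hspan : Submodule.span (Polynomial k) {q} = Ideal.span {Polynomial.X ^ m} :=
    Ideal.span_singleton_eq_span_singleton.2 hm
  rw [hspan]
  have hdim : (AdjoinRoot.powerBasis' (Polynomial.monic_X_pow (R := k) m)).dim = m := by simp
  let A : Module.Basis (Fin m) k (AdjoinRoot ((Polynomial.X : Polynomial k) ^ m)) :=
    (AdjoinRoot.powerBasis' (Polynomial.monic_X_pow (R := k) m)).basis.reindex (finCongr hdim)
  have hA : ∀ i, A i = AdjoinRoot.mk _ (Polynomial.X ^ (i : ℕ)) := fun i ↦ by
    rw [Module.Basis.reindex_apply, PowerBasis.basis_eq_pow, AdjoinRoot.powerBasis'_gen, map_pow,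
      AdjoinRoot.mk_X]
    rfl
  let B : Module.Basis (Fin m) k (Polynomial k ⧸ Ideal.span {(Polynomial.X : Polynomial k) ^ m}) :=
    A
  have hB : ∀ i, B i = Ideal.Quotient.mk _ (Polynomial.X ^ (i : ℕ)) := hA
  have hX : ∀ i, (Polynomial.X : Polynomial k) • B i =
      Ideal.Quotient.mk _ (Polynomial.X ^ ((i : ℕ) + 1)) := fun i ↦ by
    rw [hB, pow_succ', map_mul]
    rfl
  refine ⟨m, B, fun i ↦ ?_⟩
  rw [hX]
  rcases Nat.lt_or_ge (i + 1) m with h | h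
  · exact Or.inr ⟨⟨i + 1, h⟩, (hB ⟨i + 1, h⟩).symm, rfl⟩
  · have him : (i : ℕ) + 1 = m := by omega
    left
    rw [him, Ideal.Quotient.eq_zero_iff_mem]
    exact Ideal.mem_span_singleton_self _

/-- A nilpotent endomorphism of a finite-dimensional space admits a basis, graded by natural
numbers, each of whose members it kills or sends to a member of the next degree. -/
theorem exists_graded_basis_of_isNilpotent.{u, v} {k : Type u} {V : Type v} [Field k] [AddCommGroup V] [Module k V]
    [FiniteDimensional k V] {φ : V →ₗ[k] V} (hφ : IsNilpotent φ) :
    ∃ (ι : Type u) (b : Module.Basis ι k V) (d : ι → ℕ), ∀ i,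
      φ (b i) = 0 ∨ ∃ j, φ (b i) = b j ∧ d j = d i + 1 := by
  classical
  obtain ⟨N, hN⟩ := hφ
  have hkill (x : Module.AEval' φ) : (Polynomial.X ^ N : Polynomial k) • x = 0 := by
    obtain ⟨v, rfl⟩ := (Module.AEval'.of φ).surjective x
    rw [Module.AEval'.X_pow_smul_of, hN, zero_smul, map_zero]
  have htors : Module.IsTorsion (Polynomial k) (Module.AEval' φ) := fun {x} ↦
    ⟨⟨Polynomial.X ^ N, mem_nonZeroDivisors_of_ne_zero (pow_ne_zero _ Polynomial.X_ne_zero)⟩,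
      hkill x⟩
  obtain ⟨ι, _, p, -, e, ⟨E⟩⟩ := Module.equiv_directSum_of_isTorsion htors
  have hmem (i : ι) : Polynomial.X ^ N ∈ Submodule.span (Polynomial k) {p i ^ e i} := by
    rw [← Ideal.Quotient.eq_zero_iff_mem]
    have h : (Polynomial.X ^ N : Polynomial k) • DirectSum.lof (Polynomial k) ι
        (fun i ↦ Polynomial k ⧸ Submodule.span (Polynomial k) {p i ^ e i}) i
        (Ideal.Quotient.mk _ 1) = 0 := by
      apply E.symm.injective
      rw [map_smul, hkill, map_zero]
    rw [← map_smul] at h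
    have h' := DirectSum.of_injective i (h.trans (map_zero _).symm)
    rw [← mul_one (Polynomial.X ^ N : Polynomial k), map_mul]
    exact h'
  choose n b hb using fun i ↦ exists_basis_quotient_X_smul _ N (hmem i)
  let F : V ≃ₗ[k] DirectSum ι
      (fun i ↦ Polynomial k ⧸ Submodule.span (Polynomial k) {p i ^ e i}) :=
    Module.AEval'.of φ ≪≫ₗ E.restrictScalars k
  have hF (v : V) : F (φ v) = (Polynomial.X : Polynomial k) • F v := by
    change E (Module.AEval'.of φ (φ v)) = _ • E (Module.AEval'.of φ v)
    rw [← Module.AEval'.X_smul_of, map_smul]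
  let B : Module.Basis (Σ i, Fin (n i)) k V := (DFinsupp.basis b).map F.symm
  have hB (s : Σ i, Fin (n i)) : F (B s) = DirectSum.lof (Polynomial k) ι
      (fun i ↦ Polynomial k ⧸ Submodule.span (Polynomial k) {p i ^ e i}) s.1 (b s.1 s.2) := by
    simp only [B, Module.Basis.map_apply, LinearEquiv.apply_symm_apply]
    exact DFinsupp.basis_apply b s
  refine ⟨Σ i, Fin (n i), B, fun s ↦ s.2, fun s ↦ ?_⟩
  rcases hb s.1 s.2 with h | ⟨j, h, hj⟩
  · left
    apply F.injective
    rw [hF, hB, ← map_smul, h, map_zero, map_zero]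
  · refine Or.inr ⟨⟨s.1, j⟩, ?_, hj⟩
    apply F.injective
    rw [hF, hB, ← map_smul, h, hB]

/-- Twisting one tensor factor of a nilpotent endomorphism by a unit `u` does not change it up to
an automorphism which commutes with everything that commutes with `u`. -/
theorem exists_equiv_comp_map_of_isNilpotent {k V W : Type*} [Field k]
    [AddCommGroup V] [Module k V] [FiniteDimensional k V] [AddCommGroup W] [Module k W]
    {φ : V →ₗ[k] V} (hφ : IsNilpotent φ) (u : (Module.End k W)ˣ) :
    ∃ g : V ⊗[k] W ≃ₗ[k] V ⊗[k] W,
      (g : V ⊗[k] W →ₗ[k] V ⊗[k] W) ∘ₗ TensorProduct.map φ u =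
        LinearMap.rTensor W φ ∘ₗ (g : V ⊗[k] W →ₗ[k] V ⊗[k] W) ∧
      ∀ ψ : Module.End k W, Commute (u : Module.End k W) ψ →
        (g : V ⊗[k] W →ₗ[k] V ⊗[k] W) ∘ₗ LinearMap.lTensor V ψ =
          LinearMap.lTensor V ψ ∘ₗ (g : V ⊗[k] W →ₗ[k] V ⊗[k] W) := by
  obtain ⟨ι, b, d, hb⟩ := exists_graded_basis_of_isNilpotent hφ
  let G (a : Module.End k W) : V ⊗[k] W →ₗ[k] V ⊗[k] W :=
    TensorProduct.lift (b.constr k fun i ↦ TensorProduct.mk k V W (b i) ∘ₗ (a ^ d i))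
  have hG (a : Module.End k W) (i : ι) (w : W) : G a (b i ⊗ₜ w) = b i ⊗ₜ (a ^ d i) w := by
    simp [G]
  have hext {f f' : V ⊗[k] W →ₗ[k] V ⊗[k] W} (h : ∀ i w, f (b i ⊗ₜ w) = f' (b i ⊗ₜ w)) :
      f = f' :=
    TensorProduct.ext (b.ext fun i ↦ LinearMap.ext fun w ↦ h i w)
  have hinv (a c : Module.End k W) (hac : a * c = 1) (hca : c * a = 1) :
      G a ∘ₗ G c = LinearMap.id := hext fun i w ↦ by
    have hcomm : Commute a c := hac.trans hca.symm
    rw [LinearMap.comp_apply, hG, hG, ← Module.End.mul_apply, ← hcomm.mul_pow, hac, one_pow]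
    rfl
  refine ⟨LinearEquiv.ofLinearMap (G ↑u⁻¹) (G u) (hinv _ _ u.inv_mul u.mul_inv)
    (hinv _ _ u.mul_inv u.inv_mul), hext fun i w ↦ ?_, fun ψ hψ ↦ hext fun i w ↦ ?_⟩
  · simp only [LinearMap.comp_apply, LinearEquiv.coe_coe, LinearEquiv.coe_ofLinearMap,
      TensorProduct.map_tmul, hG, LinearMap.rTensor_tmul]
    rcases hb i with h | ⟨j, h, hj⟩
    · simp [h]
    · rw [h, hG, hj, pow_succ, Module.End.mul_apply, ← Module.End.mul_apply _ (u : Module.End k W),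
        u.inv_mul, Module.End.one_apply]
  · simp only [LinearMap.comp_apply, LinearEquiv.coe_coe, LinearEquiv.coe_ofLinearMap, hG,
      LinearMap.lTensor_tmul]
    rw [← Module.End.mul_apply, ← Module.End.mul_apply,
      ((hψ.units_inv_left).pow_left (d i)).eq]



/-- Let `φ`, `ψ` be nilpotent endomorphisms of finite-dimensional
`k`-vector spaces `V`, `W`.  Then `(1+φ)⊗(1+ψ) − 1` is similar to `φ⊗1 + 1⊗ψ` as an
endomorphism of `V ⊗ W`:  the "group-like" tensor operator (multiplicative formal
group law `u+v+uv`) is similar to the "Lie-algebra-like" one (additive law `u+v`). -/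
theorem stmt3 (k : Type*) [Field k]
    (V W : Type*) [AddCommGroup V] [Module k V] [FiniteDimensional k V]
    [AddCommGroup W] [Module k W] [FiniteDimensional k W]
    (φ : V →ₗ[k] V) (ψ : W →ₗ[k] W)
    (hφ : IsNilpotent φ) (hψ : IsNilpotent ψ) :
    ∃ g : V ⊗[k] W ≃ₗ[k] V ⊗[k] W,
      (g : V ⊗[k] W →ₗ[k] V ⊗[k] W) ∘ₗ
          (TensorProduct.map (LinearMap.id + φ) (LinearMap.id + ψ) - LinearMap.id) =
        (LinearMap.rTensor W φ + LinearMap.lTensor V ψ)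
          ∘ₗ (g : V ⊗[k] W →ₗ[k] V ⊗[k] W) := by
  have hu : IsUnit (LinearMap.id + ψ : Module.End k W) := hψ.isUnit_one_add
  obtain ⟨g, hgφ, hg⟩ := exists_equiv_comp_map_of_isNilpotent hφ hu.unit
  refine ⟨g, ?_⟩
  have hsplit : TensorProduct.map (LinearMap.id + φ) (LinearMap.id + ψ) - LinearMap.id =
      TensorProduct.map φ (LinearMap.id + ψ) + LinearMap.lTensor V ψ := by
    rw [TensorProduct.map_add_left, TensorProduct.map_add_right LinearMap.id,
      TensorProduct.map_id, LinearMap.lTensor]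
    abel
  have hcomm : Commute (LinearMap.id + ψ : Module.End k W) ψ :=
    (Commute.one_left ψ).add_left (Commute.refl ψ)
  rw [hsplit, LinearMap.comp_add, LinearMap.add_comp, hg ψ hcomm]
  exact congrArg (· + _) hgφ
end

section
/- Let k be a field in which m! is invertible, V a finite-dimensional k-vector space, and φ a nilpotent endomorphism of V. Let A : ⋀ᵐV → ⋀ᵐV be the endomorphism of the m-th exterior power functorially induced by the automorphism 1+φ of V (so A(v₁∧⋯∧v_m) = (1+φ)v₁ ∧ ⋯ ∧ (1+φ)v_m), and let D : ⋀ᵐV → ⋀ᵐV be a k-linear map satisfying D(v₁∧⋯∧v_m) = Σ_{i=1}^{m} v₁∧⋯∧φv_i∧⋯∧v_m for all v₁,…,v_m ∈ V. Then A − id is similar to D: there is a k-linear automorphism of ⋀ᵐV conjugating D into A − id. -/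
section ExteriorPowerSimilarity

open scoped DirectSum Polynomial

/-- A nilpotent endomorphism admits a graded basis for which it has degree one: a Jordan basis,
graded by the position in each Jordan chain. -/
theorem exists_basis_graded_of_isNilpotent {k V : Type*} [Field k] [AddCommGroup V] [Module k V]
    [FiniteDimensional k V] {φ : V →ₗ[k] V} (hφ : IsNilpotent φ) :
    ∃ (ι : Type) (_ : Finite ι) (b : Module.Basis ι k V) (deg : ι → ℕ),
      ∀ i, φ (b i) = 0 ∨ ∃ j, φ (b i) = b j ∧ deg j = deg i + 1 := by
  obtain ⟨N, hN⟩ := hφ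
  have htors : Module.IsTorsion' (Module.AEval' φ) (Submonoid.powers (Polynomial.X : k[X])) := by
    intro x
    refine ⟨⟨_, N, rfl⟩, ?_⟩
    obtain ⟨v, rfl⟩ := (Module.AEval'.of φ).surjective x
    change (Polynomial.X ^ N : k[X]) • Module.AEval'.of φ v = 0
    rw [Module.AEval'.X_pow_smul_of, hN, zero_smul, map_zero]
  obtain ⟨d, n, ⟨e⟩⟩ := Module.torsion_by_prime_power_decomposition Polynomial.irreducible_X htors
  let B (i : Fin d) : Module.Basis (Fin ((Polynomial.X : k[X]) ^ n i).natDegree) k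
      (k[X] ⧸ k[X] ∙ (Polynomial.X : k[X]) ^ n i) :=
    (AdjoinRoot.powerBasis' (Polynomial.monic_X_pow (n i))).basis
  have hB (i) (a) : B i a = Submodule.Quotient.mk (Polynomial.X ^ (a : ℕ)) := by
    refine (PowerBasis.basis_eq_pow (AdjoinRoot.powerBasis'
      (Polynomial.monic_X_pow (R := k) (n i))) a).trans ?_
    rw [AdjoinRoot.powerBasis'_gen, AdjoinRoot.root, ← map_pow]
    rfl
  let b := (DFinsupp.basis B).map ((Module.AEval'.of φ).trans (e.restrictScalars k)).symm
  have hb (i a) : e (Module.AEval'.of φ (b ⟨i, a⟩)) =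
      DirectSum.lof k[X] _ _ i (Submodule.Quotient.mk (Polynomial.X ^ (a : ℕ))) := by
    rw [← hB]
    simp [b, DFinsupp.basis, DirectSum.lof]
    rfl
  refine ⟨_, inferInstance, b, fun i => i.2, ?_⟩
  rintro ⟨i, a⟩
  have key : e (Module.AEval'.of φ (φ (b ⟨i, a⟩))) =
      DirectSum.lof k[X] _ _ i (Submodule.Quotient.mk (Polynomial.X ^ (a + 1 : ℕ))) := by
    rw [← Module.AEval'.X_smul_of, map_smul, hb, ← map_smul, ← Submodule.Quotient.mk_smul,
      smul_eq_mul, pow_succ']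
  by_cases h : (a : ℕ) + 1 < ((Polynomial.X : k[X]) ^ n i).natDegree
  · right
    refine ⟨⟨i, ⟨a + 1, h⟩⟩, ?_, rfl⟩
    apply (Module.AEval'.of φ).injective
    apply e.injective
    rw [key, hb]
  · left
    apply (Module.AEval'.of φ).injective
    apply e.injective
    rw [key, (Submodule.Quotient.mk_eq_zero _).2, map_zero, map_zero, map_zero]
    exact Ideal.mem_span_singleton.2
      (pow_dvd_pow _ ((Polynomial.natDegree_X_pow (n i)).symm.le.trans (not_lt.1 h)))

open MvPolynomial

/-- The symmetric-group-equivariant family `u i`, with constant term `1`, such that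
`∑ i, X i * u i = ∏ i, (1 + X i) - 1`. -/
noncomputable def symUnit (k : Type*) [Field k] {σ : Type*} [Fintype σ] [DecidableEq σ] (i : σ) :
    MvPolynomial σ k :=
  ∑ s : Finset σ with i ∈ s, C ((s.card : k)⁻¹) * ∏ j ∈ s.erase i, X j

section SymUnit

variable {k σ : Type*} [Field k] [Fintype σ] [DecidableEq σ]

theorem sum_X_mul_symUnit (h : ((Fintype.card σ).factorial : k) ≠ 0) :
    ∑ i, X i * symUnit k i = ∏ i : σ, (1 + X i : MvPolynomial σ k) - 1 := by
  have hs (i : σ) : X i * symUnit k i =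
      ∑ s : Finset σ, if i ∈ s then C ((s.card : k)⁻¹) * ∏ j ∈ s, X j else 0 := by
    rw [symUnit, Finset.mul_sum, Finset.sum_filter]
    refine Finset.sum_congr rfl fun s _ => ?_
    split_ifs with his
    · rw [mul_left_comm, Finset.mul_prod_erase s X his]
    · rfl
  simp_rw [hs]
  rw [Finset.sum_comm, Finset.prod_one_add, Finset.powerset_univ,
    ← Finset.add_sum_erase _ _ (Finset.mem_univ ∅)]
  simp only [Finset.notMem_empty, if_false, Finset.sum_const_zero, zero_add, Finset.prod_empty]
  rw [← Finset.add_sum_erase _ (fun s => ∏ i ∈ s, X i) (Finset.mem_univ ∅), Finset.prod_empty,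
    add_sub_cancel_left]
  refine Finset.sum_congr rfl fun s hs => ?_
  have hc : (s.card : k) ≠ 0 := by
    intro h0
    apply h
    obtain ⟨c, hc⟩ := Nat.dvd_factorial
      (Finset.card_pos.2 (Finset.nonempty_of_ne_empty (Finset.ne_of_mem_erase hs))) s.card_le_univ
    rw [hc, Nat.cast_mul, h0, zero_mul]
  rw [Finset.sum_ite_mem, Finset.univ_inter, Finset.sum_const, nsmul_eq_mul, ← mul_assoc,
    ← map_natCast (C : k →+* MvPolynomial σ k), ← map_mul, mul_inv_cancel₀ hc, map_one, one_mul]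

theorem rename_symUnit (τ : Equiv.Perm σ) (i : σ) :
    rename τ (symUnit k i) = symUnit k (τ i) := by
  simp only [symUnit, map_sum]
  refine Finset.sum_equiv τ.finsetCongr (by simp) fun s _ => ?_
  simp [map_prod, Equiv.finsetCongr_apply]
  left
  rw [show τ i = τ.toEmbedding i from rfl, ← Finset.map_erase, Finset.prod_map]
  rfl

theorem constantCoeff_symUnit (i : σ) : constantCoeff (symUnit k i) = 1 := by
  rw [symUnit, map_sum, Finset.sum_eq_single {i}]
  · simp
  · intro s hs hne
    obtain ⟨j, hj, hji⟩ : ∃ j ∈ s, j ≠ i := by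
      by_contra! h
      exact hne (Finset.eq_singleton_iff_unique_mem.2 ⟨by simpa using hs, h⟩)
    rw [map_mul, map_prod, Finset.prod_eq_zero (Finset.mem_erase.2 ⟨hji, hj⟩) (constantCoeff_X k j),
      mul_zero]
  · simp

end SymUnit

open PiTensorProduct
open scoped TensorProduct

section TensorFiltration

variable {k σ V ι : Type*} [Field k] [Fintype σ] [AddCommGroup V] [Module k V]
  (b : Module.Basis ι k V) (deg : ι → ℕ)

/-- The part of a tensor power spanned by basis tensors of total degree at least `n`. -/
def tensorFiltration (n : ℕ) : Submodule k (⨂[k] _ : σ, V) :=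
  Submodule.span k {t | ∃ j : σ → ι, n ≤ ∑ i, deg (j i) ∧ t = tprod k fun i => b (j i)}

theorem tensorFiltration_antitone : Antitone (tensorFiltration (σ := σ) b deg) := by
  intro n n' h
  refine Submodule.span_mono ?_
  rintro _ ⟨j, hj, rfl⟩
  exact ⟨j, h.trans hj, rfl⟩

end TensorFiltration

variable {k σ V : Type*} [Field k] [DecidableEq σ] [AddCommGroup V] [Module k V] (φ : V →ₗ[k] V)

/-- The endomorphism of a tensor power applying `φ` to the `i`-th factor. -/
noncomputable def tensorSlot (i : σ) : Module.End k (⨂[k] _ : σ, V) :=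
  PiTensorProduct.map (Function.update (fun _ => 1) i φ)

theorem tensorSlot_tprod (i : σ) (v : σ → V) :
    tensorSlot φ i (tprod k v) = tprod k (Function.update v i (φ (v i))) := by
  rw [tensorSlot, map_tprod]
  congr 1
  ext j
  by_cases h : j = i
  · subst h; simp
  · simp [h]

theorem tensorSlot_commute (i j : σ) : Commute (tensorSlot (k := k) φ i) (tensorSlot φ j) := by
  rw [Commute, SemiconjBy, tensorSlot, tensorSlot, ← PiTensorProduct.map_mul,
    ← PiTensorProduct.map_mul]
  congr 1
  ext l : 1
  by_cases hi : l = i <;> by_cases hj : l = j <;> simp [Function.update_apply, hi, hj]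

open scoped IsMulCommutative in
/-- The action of polynomials on a tensor power in which `X i` applies `φ` to the `i`-th factor. -/
noncomputable def tensorAction : MvPolynomial σ k →ₐ[k] Module.End k (⨂[k] _ : σ, V) :=
  haveI : IsMulCommutative (Algebra.adjoin k (Set.range (tensorSlot (k := k) (σ := σ) φ))) :=
    Algebra.isMulCommutative_adjoin k (by
      rintro _ ⟨i, rfl⟩ _ ⟨j, rfl⟩
      exact tensorSlot_commute φ i j)
  (Algebra.adjoin k (Set.range (tensorSlot φ))).val.comp
    (aeval fun i => ⟨tensorSlot φ i, Algebra.subset_adjoin (Set.mem_range_self i)⟩)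

theorem tensorAction_X (i : σ) : tensorAction φ (X i) = tensorSlot (k := k) φ i := by
  simp [tensorAction]

theorem tensorAction_mul_apply (p q : MvPolynomial σ k) (t : ⨂[k] _ : σ, V) :
    tensorAction φ (p * q) t = tensorAction φ p (tensorAction φ q t) := by
  rw [map_mul, Module.End.mul_apply]

theorem tensorAction_prod_one_add_X [Fintype σ] :
    tensorAction φ (∏ i : σ, (1 + X i)) = PiTensorProduct.map fun _ => (1 + φ : V →ₗ[k] V) := by
  have h (s : Finset σ) : tensorAction φ (∏ i ∈ s, (1 + X i)) =
      PiTensorProduct.map fun i => (if i ∈ s then 1 + φ else 1 : V →ₗ[k] V) := by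
    induction s using Finset.induction_on with
    | empty => simp [PiTensorProduct.map_one]
    | insert a s ha ih =>
      have h1 : tensorAction φ (1 + X a) =
          PiTensorProduct.map (Function.update (fun _ : σ => (1 : V →ₗ[k] V)) a (1 + φ)) := by
        rw [PiTensorProduct.map_update_add, map_add, map_one, tensorAction_X, tensorSlot,
          Function.update_eq_self a (fun _ : σ => (1 : V →ₗ[k] V)), PiTensorProduct.map_one]
      rw [Finset.prod_insert ha, map_mul, ih, h1, ← PiTensorProduct.map_mul]
      congr 1
      ext i : 1
      by_cases hi : i = a
      · subst hi; simp [ha]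
      · simp [hi]
  simpa using h Finset.univ

theorem reindex_tensorAction (τ : Equiv.Perm σ) (p : MvPolynomial σ k) (t : ⨂[k] _ : σ, V) :
    reindex k (fun _ => V) τ (tensorAction φ p t) =
      tensorAction φ (rename τ p) (reindex k (fun _ => V) τ t) := by
  induction p using MvPolynomial.induction_on generalizing t with
  | C a => simp [← algebraMap_eq]
  | add p q hp hq => simp only [map_add, LinearMap.add_apply, hp, hq]
  | mul_X p i hp =>
    rw [tensorAction_mul_apply, hp, map_mul, tensorAction_mul_apply, rename_X, tensorAction_X,
      tensorAction_X]
    congr 1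
    induction t using PiTensorProduct.induction_on with
    | smul_tprod r v =>
      simp only [map_smul, tensorSlot_tprod, reindex_tprod]
      congr 2
      ext j
      by_cases h : j = τ i
      · subst h
        simp only [Function.update_self, Equiv.symm_apply_apply]
        exact congrArg (φ <| v ·) (τ.symm_apply_apply i).symm
      · simp [h, Equiv.symm_apply_eq]
    | add x y hx hy => simp only [map_add, hx, hy]

variable {φ} {ι : Type*} (b : Module.Basis ι k V) (deg : ι → ℕ)

theorem tensorSlot_tprod_basis
    (hdeg : ∀ i, φ (b i) = 0 ∨ ∃ j, φ (b i) = b j ∧ deg j = deg i + 1) (i : σ) (j : σ → ι) :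
    tensorSlot φ i (tprod k fun l => b (j l)) = 0 ∨
      ∃ c, tensorSlot φ i (tprod k fun l => b (j l)) =
        (tprod k fun l => b (Function.update j i c l)) ∧ deg c = deg (j i) + 1 := by
  rw [tensorSlot_tprod]
  rcases hdeg (j i) with h | ⟨c, h, hc⟩
  · left
    exact (PiTensorProduct.tprod k).map_coord_zero i (by simp [h])
  · right
    refine ⟨c, ?_, hc⟩
    congr 1
    ext l
    by_cases hl : l = i
    · subst hl; simp [h]
    · simp [hl]

variable [Fintype σ]

theorem tensorSlot_mem_tensorFiltration
    (hdeg : ∀ i, φ (b i) = 0 ∨ ∃ j, φ (b i) = b j ∧ deg j = deg i + 1) (i : σ) {n : ℕ}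
    {t : ⨂[k] _ : σ, V} (ht : t ∈ tensorFiltration b deg n) :
    tensorSlot φ i t ∈ tensorFiltration b deg (n + 1) := by
  induction ht using Submodule.span_induction with
  | zero => simp
  | add x y _ _ hx hy => rw [map_add]; exact add_mem hx hy
  | smul a x _ hx => rw [map_smul]; exact Submodule.smul_mem _ _ hx
  | mem x hx =>
    obtain ⟨j, hj, rfl⟩ := hx
    rcases tensorSlot_tprod_basis b deg hdeg i j with h | ⟨c, h, hc⟩
    · rw [h]; exact zero_mem _
    · rw [h]
      refine Submodule.subset_span ⟨_, ?_, rfl⟩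
      have h1 := Finset.add_sum_erase Finset.univ (fun l => deg (j l)) (Finset.mem_univ i)
      rw [← Finset.add_sum_erase Finset.univ _ (Finset.mem_univ i), Function.update_self, hc,
        Finset.sum_congr rfl fun l hl => by
          rw [Function.update_of_ne (Finset.ne_of_mem_erase hl)]]
      omega

theorem tensorAction_sub_smul_mem_tensorFiltration
    (hdeg : ∀ i, φ (b i) = 0 ∨ ∃ j, φ (b i) = b j ∧ deg j = deg i + 1) (p : MvPolynomial σ k)
    {n : ℕ} {t : ⨂[k] _ : σ, V} (ht : t ∈ tensorFiltration b deg n) :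
    tensorAction φ p t - constantCoeff p • t ∈ tensorFiltration b deg (n + 1) := by
  induction p using MvPolynomial.induction_on generalizing t n with
  | C a => simp [← algebraMap_eq]
  | add p q hp hq =>
    rw [map_add, map_add, LinearMap.add_apply, add_smul, add_sub_add_comm]
    exact add_mem (hp ht) (hq ht)
  | mul_X p i hp =>
    have h := tensorSlot_mem_tensorFiltration b deg hdeg i ht
    rw [tensorAction_mul_apply, tensorAction_X, map_mul, constantCoeff_X, mul_zero, zero_smul,
      sub_zero, ← sub_add_cancel (tensorAction φ p _)]
    exact add_mem (tensorFiltration_antitone b deg (Nat.le_succ _) (hp h))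
      (Submodule.smul_mem _ _ h)

variable (φ)

/-- The substitution `X i ↦ X i * symUnit k i`, transported to a tensor power of `V` by means of a
graded basis of `V`. -/
noncomputable def tensorSubst : Module.End k (⨂[k] _ : σ, V) :=
  (Basis.piTensorProduct fun _ : σ => b).constr k fun j =>
    tensorAction φ (∏ i, symUnit k i ^ deg (j i)) (tprod k fun i => b (j i))

theorem tensorSubst_tprod (j : σ → ι) :
    tensorSubst φ b deg (tprod k fun i => b (j i)) =
      tensorAction φ (∏ i, symUnit k i ^ deg (j i)) (tprod k fun i => b (j i)) := by
  rw [tensorSubst, ← Basis.piTensorProduct_apply (fun _ : σ => b) j, Module.Basis.constr_basis,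
    Basis.piTensorProduct_apply]

theorem tensorSubst_tensorSlot
    (hdeg : ∀ i, φ (b i) = 0 ∨ ∃ j, φ (b i) = b j ∧ deg j = deg i + 1) (i : σ)
    (t : ⨂[k] _ : σ, V) :
    tensorSubst φ b deg (tensorSlot φ i t) =
      tensorAction φ (X i * symUnit k i) (tensorSubst φ b deg t) := by
  suffices h : tensorSubst φ b deg ∘ₗ tensorSlot φ i =
      tensorAction φ (X i * symUnit k i) ∘ₗ tensorSubst φ b deg from DFunLike.congr_fun h t
  refine (Basis.piTensorProduct fun _ : σ => b).ext fun j => ?_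
  rw [Basis.piTensorProduct_apply, LinearMap.comp_apply, LinearMap.comp_apply, tensorSubst_tprod,
    ← tensorAction_mul_apply, mul_assoc, mul_comm (X i), tensorAction_mul_apply, tensorAction_X]
  rcases tensorSlot_tprod_basis b deg hdeg i j with h | ⟨c, h, hc⟩
  · rw [h, map_zero, map_zero]
  · rw [h, tensorSubst_tprod, ← Finset.mul_prod_erase Finset.univ _ (Finset.mem_univ i),
      ← Finset.mul_prod_erase Finset.univ (fun l => symUnit k l ^ deg (j l)) (Finset.mem_univ i),
      Function.update_self, hc, pow_succ', mul_assoc, Finset.prod_congr rfl fun l hl => by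
        rw [Function.update_of_ne (Finset.ne_of_mem_erase hl)]]

theorem reindex_tensorSubst (τ : Equiv.Perm σ) (t : ⨂[k] _ : σ, V) :
    reindex k (fun _ => V) τ (tensorSubst φ b deg t) =
      tensorSubst φ b deg (reindex k (fun _ => V) τ t) := by
  suffices h : (reindex k (fun _ => V) τ).toLinearMap ∘ₗ tensorSubst φ b deg =
      tensorSubst φ b deg ∘ₗ (reindex k (fun _ => V) τ).toLinearMap from DFunLike.congr_fun h t
  refine (Basis.piTensorProduct fun _ : σ => b).ext fun j => ?_
  rw [Basis.piTensorProduct_apply, LinearMap.comp_apply, LinearMap.comp_apply, tensorSubst_tprod,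
    LinearEquiv.coe_coe, reindex_tensorAction, reindex_tprod,
    tensorSubst_tprod φ b deg fun i => j (τ.symm i), map_prod]
  simp only [map_pow, rename_symUnit]
  rw [← Equiv.prod_comp τ fun i => symUnit k i ^ deg (j (τ.symm i))]
  simp only [Equiv.symm_apply_apply]

theorem tensorSubst_surjective [Finite ι]
    (hdeg : ∀ i, φ (b i) = 0 ∨ ∃ j, φ (b i) = b j ∧ deg j = deg i + 1) :
    Function.Surjective (tensorSubst (σ := σ) φ b deg) := by
  obtain ⟨N, hN⟩ : ∃ N, ∀ j : σ → ι, ∑ i, deg (j i) < N := by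
    obtain ⟨N, hN⟩ := (Set.finite_range fun j : σ → ι => ∑ i, deg (j i)).bddAbove
    exact ⟨N + 1, fun j => Nat.lt_succ_of_le (hN ⟨j, rfl⟩)⟩
  have hF (n : ℕ) : tensorFiltration (σ := σ) b deg (N - n) ≤
      LinearMap.range (tensorSubst (σ := σ) φ b deg) := by
    induction n with
    | zero =>
      refine Submodule.span_le.2 ?_
      rintro _ ⟨j, hj, rfl⟩
      exact absurd (hN j) (not_lt.2 hj)
    | succ n ih =>
      refine Submodule.span_le.2 ?_
      rintro _ ⟨j, hj, rfl⟩
      have h := tensorAction_sub_smul_mem_tensorFiltration b deg hdeg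
        (∏ i, symUnit k i ^ deg (j i)) (Submodule.subset_span ⟨j, hj, rfl⟩)
      rw [← tensorSubst_tprod, map_prod,
        Finset.prod_eq_one fun i _ => by rw [map_pow, constantCoeff_symUnit, one_pow],
        one_smul] at h
      have h' := ih (tensorFiltration_antitone b deg (by omega) h)
      have := sub_mem (LinearMap.mem_range_self (tensorSubst φ b deg)
        (PiTensorProduct.tprod k fun i => b (j i))) h'
      rwa [sub_sub_cancel] at this
  rw [← LinearMap.range_eq_top, eq_top_iff, ← (Basis.piTensorProduct fun _ : σ => b).span_eq,
    Submodule.span_le]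
  rintro _ ⟨j, rfl⟩
  refine hF N (Submodule.subset_span ⟨j, by simp, ?_⟩)
  rw [Basis.piTensorProduct_apply]

theorem tensorSubst_sum_X
    (hdeg : ∀ i, φ (b i) = 0 ∨ ∃ j, φ (b i) = b j ∧ deg j = deg i + 1)
    (h : ((Fintype.card σ).factorial : k) ≠ 0) (t : ⨂[k] _ : σ, V) :
    tensorSubst φ b deg (tensorAction φ (∑ i, X i) t) =
      tensorAction φ (∏ i, (1 + X i)) (tensorSubst φ b deg t) - tensorSubst φ b deg t := by
  rw [map_sum, LinearMap.sum_apply, map_sum]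
  simp_rw [tensorAction_X, tensorSubst_tensorSlot φ b deg hdeg]
  rw [← LinearMap.sum_apply, ← map_sum, sum_X_mul_symUnit h, map_sub, map_one,
    LinearMap.sub_apply, Module.End.one_apply]

variable (k V) in
/-- The canonical map from the tensor power to the exterior power. -/
noncomputable def tensorToExterior (m : ℕ) : (⨂[k] _ : Fin m, V) →ₗ[k] ⋀[k]^m V :=
  PiTensorProduct.lift (exteriorPower.ιMulti k m).toMultilinearMap

theorem tensorToExterior_tprod {m : ℕ} (v : Fin m → V) :
    tensorToExterior k V m (tprod k v) = exteriorPower.ιMulti k m v :=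
  lift.tprod v

theorem tensorToExterior_surjective (m : ℕ) : Function.Surjective (tensorToExterior k V m) := by
  rw [← LinearMap.range_eq_top, eq_top_iff, ← exteriorPower.ιMulti_span, Submodule.span_le]
  rintro _ ⟨v, rfl⟩
  exact ⟨tprod k v, tensorToExterior_tprod v⟩

theorem tensorToExterior_reindex_swap {m : ℕ} {i j : Fin m} (hij : i ≠ j)
    (t : ⨂[k] _ : Fin m, V) :
    tensorToExterior k V m (reindex k (fun _ => V) (Equiv.swap i j) t) =
      -tensorToExterior k V m t := by
  induction t using PiTensorProduct.induction_on with
  | smul_tprod r v =>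
    rw [map_smul, map_smul, map_smul, reindex_tprod, tensorToExterior_tprod,
      tensorToExterior_tprod, Equiv.symm_swap]
    exact (congrArg (r • ·) ((exteriorPower.ιMulti k m).map_swap v hij)).trans (smul_neg _ _)
  | add x y hx hy => rw [map_add, map_add, map_add, hx, hy, neg_add]

/-- An endomorphism of a tensor power that commutes with transpositions descends to the exterior
power. -/
theorem exists_comp_tensorToExterior {m : ℕ} (hm : (m.factorial : k) ≠ 0)
    (g : Module.End k (⨂[k] _ : Fin m, V))
    (hg : ∀ (i j : Fin m) (t : ⨂[k] _ : Fin m, V),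
      reindex k (fun _ => V) (Equiv.swap i j) (g t) =
        g (reindex k (fun _ => V) (Equiv.swap i j) t)) :
    ∃ f : (⋀[k]^m V) →ₗ[k] ⋀[k]^m V,
      ∀ t, f (tensorToExterior k V m t) = tensorToExterior k V m (g t) := by
  let a : V [⋀^Fin m]→ₗ[k] ⋀[k]^m V :=
    { (tensorToExterior k V m ∘ₗ g).compMultilinearMap (tprod k) with
      map_eq_zero_of_eq' := by
        intro v i j hv hij
        have h2 : (2 : k) ≠ 0 := by
          intro h0
          obtain ⟨c, hc⟩ := Nat.dvd_factorial two_pos (show 2 ≤ m by omega)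
          apply hm
          rw [hc, Nat.cast_mul, Nat.cast_two, h0, zero_mul]
        have h := tensorToExterior_reindex_swap hij (g (tprod k v))
        rw [hg, reindex_tprod, Equiv.symm_swap] at h
        have hvs : (fun l => v (Equiv.swap i j l)) = v := by
          ext l
          by_cases hi : l = i
          · subst hi; simp [hv]
          · by_cases hj : l = j
            · subst hj; simp [hv]
            · rw [Equiv.swap_apply_of_ne_of_ne hi hj]
        rw [hvs, eq_neg_iff_add_eq_zero, ← two_smul k] at h
        exact (smul_eq_zero.1 h).resolve_left h2 }
  refine ⟨exteriorPower.alternatingMapLinearEquiv a, fun t => ?_⟩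
  suffices h : exteriorPower.alternatingMapLinearEquiv a ∘ₗ tensorToExterior k V m =
      tensorToExterior k V m ∘ₗ g from DFunLike.congr_fun h t
  ext v
  simp only [LinearMap.compMultilinearMap_apply, LinearMap.comp_apply, tensorToExterior_tprod,
    exteriorPower.alternatingMapLinearEquiv_apply_ιMulti]
  rfl

end ExteriorPowerSimilarity


/-- The wedge `v₁ ∧ ⋯ ∧ v_m`, as an element of the `m`-th exterior power `⋀ᵐV`
(the `m`-th graded piece of the exterior algebra). -/
noncomputable def wedge (k : Type*) [Field k] (V : Type*) [AddCommGroup V] [Module k V]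
    (m : ℕ) (v : Fin m → V) : ⋀[k]^m V :=
  ⟨ExteriorAlgebra.ιMulti k m v, ExteriorAlgebra.ιMulti_range k m (Set.mem_range_self v)⟩

/-- Let `k` be a field in which `m!` is invertible, `V` a
finite-dimensional `k`-vector space and `φ` a nilpotent endomorphism of `V`.  Let
`A : ⋀ᵐV → ⋀ᵐV` be induced functorially by `1 + φ` (so
`A(v₁∧⋯∧v_m) = (1+φ)v₁ ∧ ⋯ ∧ (1+φ)v_m`) and let `D : ⋀ᵐV → ⋀ᵐV` satisfy
`D(v₁∧⋯∧v_m) = Σᵢ v₁∧⋯∧φvᵢ∧⋯∧v_m`.  Then `A − id` is similar to `D`. -/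
theorem stmt8 (k : Type*) [Field k] (m : ℕ)
    (hm : (Nat.factorial m : k) ≠ 0)
    (V : Type*) [AddCommGroup V] [Module k V] [FiniteDimensional k V]
    (φ : V →ₗ[k] V) (hφ : IsNilpotent φ)
    (A D : (⋀[k]^m V) →ₗ[k] (⋀[k]^m V))
    (hA : ∀ v : Fin m → V, A (wedge k V m v) = wedge k V m fun i => v i + φ (v i))
    (hD : ∀ v : Fin m → V,
      D (wedge k V m v) = ∑ i : Fin m, wedge k V m (Function.update v i (φ (v i)))) :
    ∃ g : (⋀[k]^m V) ≃ₗ[k] (⋀[k]^m V),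
      ∀ x : ⋀[k]^m V, g (D x) = A (g x) - g x := by
  have hw (v : Fin m → V) : wedge k V m v = tensorToExterior k V m (PiTensorProduct.tprod k v) :=
    (tensorToExterior_tprod v).symm
  have hAπ (t : PiTensorProduct k fun _ : Fin m => V) : A (tensorToExterior k V m t) =
      tensorToExterior k V m (tensorAction φ (∏ i, (1 + MvPolynomial.X i)) t) := by
    rw [tensorAction_prod_one_add_X]
    induction t using PiTensorProduct.induction_on with
    | smul_tprod r v =>
      simp only [map_smul, PiTensorProduct.map_tprod, ← hw, hA]
      rfl
    | add x y hx hy => simp only [map_add, hx, hy]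
  have hDπ (t : PiTensorProduct k fun _ : Fin m => V) : D (tensorToExterior k V m t) =
      tensorToExterior k V m (tensorAction φ (∑ i, MvPolynomial.X i) t) := by
    simp only [map_sum, tensorAction_X, LinearMap.sum_apply]
    induction t using PiTensorProduct.induction_on with
    | smul_tprod r v => simp only [map_smul, tensorSlot_tprod, ← hw, hD, Finset.smul_sum]
    | add x y hx hy => simp only [map_add, hx, hy, Finset.sum_add_distrib]
  obtain ⟨ι, _, b, deg, hdeg⟩ := exists_basis_graded_of_isNilpotent hφ
  obtain ⟨f, hf⟩ := exists_comp_tensorToExterior hm (tensorSubst φ b deg)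
    fun i j => reindex_tensorSubst φ b deg (Equiv.swap i j)
  have hsurj : Function.Surjective f := by
    refine Function.Surjective.of_comp (g := tensorToExterior k V m) ?_
    rw [show f ∘ tensorToExterior k V m = tensorToExterior k V m ∘ tensorSubst φ b deg from
      funext hf]
    exact (tensorToExterior_surjective m).comp (tensorSubst_surjective φ b deg hdeg)
  refine ⟨LinearEquiv.ofBijective f ⟨LinearMap.injective_iff_surjective.2 hsurj, hsurj⟩,
    fun x => ?_⟩
  obtain ⟨t, rfl⟩ := tensorToExterior_surjective m x
  change f (D _) = A (f _) - f _
  rw [hDπ, hf, hf, hAπ, tensorSubst_sum_X φ b deg hdeg (by rwa [Fintype.card_fin]), map_sub]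
end

section
/- Let k be a field of characteristic ≠ 2, n ≥ 1, and J ∈ GL_n(k) an invertible matrix with Jᵀ = J or Jᵀ = −J (so J defines a nondegenerate symmetric or alternating bilinear form on kⁿ). Let 𝔬 = { Y ∈ M_n(k) : Yᵀ J + J Y = 0 } be the Lie algebra of the corresponding isometry group. Let X ∈ 𝔬 be nilpotent. Then 1 + X is invertible, the Cayley transform u = (1 − X)(1 + X)⁻¹ satisfies uᵀ J u = J and is unipotent, conjugation by u preserves 𝔬, and the endomorphism of 𝔬 given by Y ↦ uYu⁻¹ − Y is similar (as a k-linear endomorphism of the vector space 𝔬) to the endomorphism Y ↦ XY − YX. In particular Ad(u) − 1 and ad(X) have the same Jordan block partition on 𝔬. -/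
open scoped Matrix
/-- The space `𝔬 = { Y ∈ M_n(k) : Yᵀ J + J Y = 0 }` of `J`-skew-adjoint matrices
(the Lie algebra of the isometry group of the bilinear form defined by `J`),
as a `k`-submodule of `M_n(k)`. -/
def isometryLieAlg (k : Type*) [Field k] (n : ℕ) (J : Matrix (Fin n) (Fin n) k) :
    Submodule k (Matrix (Fin n) (Fin n) k) where
  carrier := {Y | Yᵀ * J + J * Y = 0}
  zero_mem' := by simp
  add_mem' := by
    intro a b ha hb
    simp only [Set.mem_setOf_eq] at ha hb ⊢
    have : (a + b)ᵀ * J + J * (a + b) = (aᵀ * J + J * a) + (bᵀ * J + J * b) := by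
      simp only [Matrix.transpose_add, Matrix.add_mul, Matrix.mul_add]
      abel
    rw [this, ha, hb, add_zero]
  smul_mem' := by
    intro c a ha
    simp only [Set.mem_setOf_eq] at ha ⊢
    have : (c • a)ᵀ * J + J * (c • a) = c • (aᵀ * J + J * a) := by
      simp only [Matrix.transpose_smul, Matrix.smul_mul, Matrix.mul_smul, smul_add]
    rw [this, ha, smul_zero]

open Polynomial Module in
/-- A nilpotent endomorphism `D` is similar to its product with any automorphism commuting
with it. -/
theorem exists_linearEquiv_mul_eq_of_isNilpotent {k V : Type*} [Field k] [AddCommGroup V]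
    [Module k V] [FiniteDimensional k V] {D C : Module.End k V} (hD : IsNilpotent D)
    (hC : IsUnit C) (hDC : Commute D C) :
    ∃ g : V ≃ₗ[k] V, ∀ v, g ((D * C) v) = D (g v) := by
  classical
  obtain ⟨N, hN⟩ := hD
  let ofD := AEval'.of D
  let ofE := AEval'.of (D * C)
  have htors : Module.IsTorsion' (AEval' D) (Submonoid.powers (X : k[X])) := by
    intro x
    refine ⟨⟨X ^ N, N, rfl⟩, ?_⟩
    obtain ⟨v, rfl⟩ := ofD.surjective x
    change (X ^ N : k[X]) • ofD v = 0
    rw [AEval.X_pow_smul_of, hN, zero_smul, map_zero]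
  obtain ⟨d, m, ⟨e⟩⟩ := Module.torsion_by_prime_power_decomposition
    (irreducible_X (R := k)) htors
  let b (i : Fin d) : V := ofD.symm (e.symm (DirectSum.lof k[X] (Fin d)
    (fun i ↦ k[X] ⧸ k[X] ∙ (X : k[X]) ^ m i) i (Submodule.Quotient.mk 1)))
  have hb (i : Fin d) : (D ^ m i) (b i) = 0 := by
    apply ofD.injective
    have h : (X ^ m i : k[X]) • ofD (b i) = 0 := by
      simp only [b, LinearEquiv.apply_symm_apply]
      rw [← map_smul, ← map_smul, ← Submodule.Quotient.mk_smul, smul_eq_mul, mul_one,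
        (Submodule.Quotient.mk_eq_zero _).2 (Submodule.mem_span_singleton_self _), map_zero,
        map_zero]
    rw [AEval.X_pow_smul_of] at h
    rw [map_zero]
    exact h
  let f (i : Fin d) : (k[X] ⧸ k[X] ∙ (X : k[X]) ^ m i) →ₗ[k[X]] AEval' (D * C) :=
    Submodule.liftQSpanSingleton ((X : k[X]) ^ m i)
      (LinearMap.toSpanSingleton k[X] _ (ofE (b i))) (by
        rw [LinearMap.toSpanSingleton_apply, AEval.X_pow_smul_of, hDC.mul_pow,
          (hDC.pow_pow _ _).eq]
        change ofE ((C ^ m i) ((D ^ m i) (b i))) = 0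
        rw [hb, map_zero, map_zero])
  have hf (i : Fin d) (p : k[X]) : f i (Submodule.Quotient.mk p) = p • ofE (b i) :=
    Submodule.liftQSpanSingleton_apply _ _ _ _
  let φ := DirectSum.toModule k[X] (Fin d) (AEval' (D * C)) f
  have hφ (x) : ∃ z, ofE.symm (φ x) = ofD.symm (e.symm x) + D z := by
    induction x using DirectSum.induction_on with
    | zero => exact ⟨0, by simp⟩
    | add x y hx hy =>
      obtain ⟨z, hz⟩ := hx
      obtain ⟨w, hw⟩ := hy
      refine ⟨z + w, ?_⟩
      simp only [map_add, hz, hw]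
      abel
    | of i x =>
      obtain ⟨p, rfl⟩ := Submodule.Quotient.mk_surjective _ x
      have h₁ : φ (DirectSum.of _ i (Submodule.Quotient.mk p)) = p • ofE (b i) := by
        rw [← hf]
        exact DirectSum.toModule_lof ..
      have h₂ : e.symm (DirectSum.of _ i (Submodule.Quotient.mk p)) = p • ofD (b i) := by
        simp only [b, LinearEquiv.apply_symm_apply]
        rw [← map_smul, ← map_smul, ← Submodule.Quotient.mk_smul, smul_eq_mul, mul_one]
        rfl
      rw [h₁, h₂, ← AEval.of_aeval_smul, ← AEval.of_aeval_smul]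
      change ∃ z, (aeval (D * C) p) (b i) = (aeval D p) (b i) + D z
      refine ⟨C ((aeval (D * C) p.divX) (b i)) - (aeval D p.divX) (b i), ?_⟩
      conv_lhs => rw [← X_mul_divX_add p]
      conv_rhs => enter [1]; rw [← X_mul_divX_add p]
      simp only [map_add, map_mul, aeval_X, aeval_C, LinearMap.add_apply, Module.End.mul_apply,
        Module.algebraMap_end_apply, map_sub]
      abel
  let g : V →ₗ[k] V :=
    ofE.symm.toLinearMap ∘ₗ (φ ∘ₗ e.toLinearMap).restrictScalars k ∘ₗ ofD.toLinearMap
  have hg (v : V) : g (D v) = (D * C) (g v) := by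
    change ofE.symm (φ (e (ofD (D v)))) = (D * C) (ofE.symm (φ (e (ofD v))))
    have : ofD (D v) = (X : k[X]) • ofD v := (AEval.X_smul_of D v).symm
    rw [this, map_smul, map_smul, AEval.of_symm_X_smul]
    rfl
  have hg_pow (j : ℕ) (v : V) : g ((D ^ j) v) = ((D * C) ^ j) (g v) := by
    induction j with
    | zero => simp
    | succ j ih => rw [pow_succ', pow_succ', Module.End.mul_apply, hg, ih, ← Module.End.mul_apply]
  obtain ⟨c, rfl⟩ := hC
  have hstep (v : V) : ∃ w z, v = g w + (D * c) z := by
    obtain ⟨z, hz⟩ := hφ (e (ofD v))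
    refine ⟨v, -((c⁻¹ : (Module.End k V)ˣ) : Module.End k V) z, ?_⟩
    have h : (D * (c : Module.End k V)) (((c⁻¹ : (Module.End k V)ˣ) : Module.End k V) z) = D z := by
      rw [← Module.End.mul_apply, Units.mul_inv_cancel_right]
    rw [map_neg, h]
    change v = ofE.symm (φ (e (ofD v))) + _
    rw [hz]
    simp
  have happrox (j : ℕ) (v : V) : ∃ w z, v = g w + ((D * c) ^ j) z := by
    induction j with
    | zero => exact ⟨0, v, by simp⟩
    | succ j ih =>
      obtain ⟨w, z, h⟩ := ih
      obtain ⟨w', z', h'⟩ := hstep z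
      refine ⟨w + (D ^ j) w', z', ?_⟩
      rw [h, map_add, hg_pow, pow_succ, Module.End.mul_apply, add_assoc, ← map_add, ← h']
  have hsurj : Function.Surjective g := fun v ↦ by
    obtain ⟨w, z, h⟩ := happrox N v
    refine ⟨w, ?_⟩
    rw [h, hDC.mul_pow, hN]
    simp
  let G := LinearEquiv.ofBijective g ⟨LinearMap.injective_iff_surjective.2 hsurj, hsurj⟩
  refine ⟨G.symm, fun v ↦ ?_⟩
  rw [LinearEquiv.symm_apply_eq]
  change _ = g (D (G.symm v))
  rw [hg]
  change _ = (D * _) (G (G.symm v))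
  rw [LinearEquiv.apply_symm_apply]

theorem mem_isometryLieAlg_iff {k : Type*} [Field k] {n : ℕ} {J Y : Matrix (Fin n) (Fin n) k} :
    Y ∈ isometryLieAlg k n J ↔ Yᵀ * J = -(J * Y) :=
  eq_neg_iff_add_eq_zero.symm

theorem commutator_mem_isometryLieAlg {k : Type*} [Field k] {n : ℕ}
    {J X Y : Matrix (Fin n) (Fin n) k} (hX : X ∈ isometryLieAlg k n J)
    (hY : Y ∈ isometryLieAlg k n J) : X * Y - Y * X ∈ isometryLieAlg k n J := by
  rw [mem_isometryLieAlg_iff] at *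
  simp only [Matrix.transpose_sub, Matrix.transpose_mul, sub_mul, mul_assoc, hX, hY, mul_neg,
    mul_sub]
  simp only [← mul_assoc, hX, hY, neg_mul]
  abel

theorem mul_mul_mem_isometryLieAlg {k : Type*} [Field k] {n : ℕ}
    {J X Y : Matrix (Fin n) (Fin n) k} (hX : X ∈ isometryLieAlg k n J)
    (hY : Y ∈ isometryLieAlg k n J) : X * Y * X ∈ isometryLieAlg k n J := by
  rw [mem_isometryLieAlg_iff] at *
  rw [Matrix.transpose_mul, Matrix.transpose_mul, mul_assoc, mul_assoc, hX, mul_neg, mul_neg,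
    ← mul_assoc Yᵀ, hY, neg_mul, mul_neg, mul_assoc J, ← mul_assoc, hX]
  simp only [neg_mul, neg_neg, mul_assoc]

theorem conj_mem_isometryLieAlg {k : Type*} [Field k] {n : ℕ}
    {J u Y : Matrix (Fin n) (Fin n) k} (hu : IsUnit u) (huJ : uᵀ * J * u = J)
    (hY : Y ∈ isometryLieAlg k n J) : u * Y * u⁻¹ ∈ isometryLieAlg k n J := by
  have hdet := (Matrix.isUnit_iff_isUnit_det u).1 hu
  have h₁ : uᵀ * J = J * u⁻¹ := by
    conv_rhs => rw [← huJ]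
    rw [Matrix.mul_nonsing_inv_cancel_right _ _ hdet]
  have h₂ : u⁻¹ᵀ * J = J * u := by
    conv_lhs => rw [← huJ]
    rw [← mul_assoc, ← mul_assoc, ← Matrix.transpose_mul, Matrix.mul_nonsing_inv _ hdet,
      Matrix.transpose_one, one_mul]
  rw [mem_isometryLieAlg_iff] at *
  rw [Matrix.transpose_mul, Matrix.transpose_mul, mul_assoc, mul_assoc, h₁, ← mul_assoc Yᵀ, hY,
    neg_mul, mul_neg, mul_assoc J, ← mul_assoc, h₂, mul_assoc, mul_assoc]

theorem transpose_mul_mul_cayley {k : Type*} [Field k] {n : ℕ}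
    {J X : Matrix (Fin n) (Fin n) k} (hX : X ∈ isometryLieAlg k n J) (h : IsUnit (1 + X)) :
    ((1 - X) * (1 + X)⁻¹)ᵀ * J * ((1 - X) * (1 + X)⁻¹) = J := by
  have hdet := (Matrix.isUnit_iff_isUnit_det _).1 h
  rw [mem_isometryLieAlg_iff] at hX
  have h₁ : (1 - X)ᵀ * J = J * (1 + X) := by
    rw [Matrix.transpose_sub, Matrix.transpose_one, sub_mul, hX]
    noncomm_ring
  have h₂ : J * (1 - X) = (1 + X)ᵀ * J := by
    rw [Matrix.transpose_add, Matrix.transpose_one, add_mul, hX]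
    noncomm_ring
  have hc : (1 + X) * (1 - X) = (1 - X) * (1 + X) := by noncomm_ring
  rw [Matrix.transpose_mul, mul_assoc, mul_assoc, ← mul_assoc _ J, h₁, mul_assoc,
    ← mul_assoc (1 + X), hc, Matrix.mul_nonsing_inv_cancel_right _ _ hdet, h₂, ← mul_assoc,
    ← Matrix.transpose_mul, Matrix.mul_nonsing_inv _ hdet, Matrix.transpose_one, one_mul]

/-- Let `k` be a field of characteristic `≠ 2`, `J ∈ GL_n(k)` with
`Jᵀ = J` or `Jᵀ = −J`, and `𝔬 = { Y : Yᵀ J + J Y = 0 }` the Lie algebra of the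
corresponding isometry group.  Let `X ∈ 𝔬` be nilpotent.  Then `1 + X` is invertible,
the Cayley transform `u = (1 − X)(1 + X)⁻¹` is a unipotent isometry (`uᵀ J u = J`),
conjugation by `u` preserves `𝔬`, and `Ad(u) − 1 : Y ↦ uYu⁻¹ − Y` is similar, as a
`k`-linear endomorphism of `𝔬`, to `ad(X) : Y ↦ XY − YX`; in particular they have the
same Jordan block partition on `𝔬`. -/
theorem stmt11 (k : Type*) [Field k] (hchar : (2 : k) ≠ 0) (n : ℕ) (hn : 1 ≤ n)
    (J : Matrix (Fin n) (Fin n) k) (hJ : IsUnit J) (hJsym : Jᵀ = J ∨ Jᵀ = -J)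
    (X : Matrix (Fin n) (Fin n) k) (hXmem : X ∈ isometryLieAlg k n J)
    (hXnil : IsNilpotent X)
    (u : Matrix (Fin n) (Fin n) k) (hu : u = (1 - X) * (1 + X)⁻¹) :
    IsUnit (1 + X) ∧
    uᵀ * J * u = J ∧
    IsUnit u ∧ IsNilpotent (u - 1) ∧
    (∀ Y ∈ isometryLieAlg k n J, u * Y * u⁻¹ ∈ isometryLieAlg k n J) ∧
    ∃ (had : ∀ Y ∈ isometryLieAlg k n J, X * Y - Y * X ∈ isometryLieAlg k n J)
      (hAd : ∀ Y ∈ isometryLieAlg k n J, u * Y * u⁻¹ - Y ∈ isometryLieAlg k n J)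
      (g : isometryLieAlg k n J ≃ₗ[k] isometryLieAlg k n J),
      ∀ Y : isometryLieAlg k n J,
        g ⟨u * (Y : Matrix (Fin n) (Fin n) k) * u⁻¹ - (Y : Matrix (Fin n) (Fin n) k),
            hAd _ Y.2⟩ =
          ⟨X * ((g Y : isometryLieAlg k n J) : Matrix (Fin n) (Fin n) k) -
              ((g Y : isometryLieAlg k n J) : Matrix (Fin n) (Fin n) k) * X,
            had _ (g Y).2⟩ := by
  have hp : IsUnit (1 + X) := hXnil.isUnit_one_add
  have hm : IsUnit (1 - X) := hXnil.isUnit_one_sub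
  have hpdet := (Matrix.isUnit_iff_isUnit_det _).1 hp
  have huJ : uᵀ * J * u = J := hu ▸ transpose_mul_mul_cayley hXmem hp
  have huu : IsUnit u := hu ▸ hm.mul (Matrix.isUnit_nonsing_inv_iff.2 hp)
  have hudet := (Matrix.isUnit_iff_isUnit_det _).1 huu
  have hup : u * (1 + X) = 1 - X := by rw [hu, Matrix.nonsing_inv_mul_cancel_right _ _ hpdet]
  have hcomm : Commute (1 + X) (1 - X) :=
    ((Commute.one_left _).add_left ((Commute.one_right X).sub_right (Commute.refl X)))
  have hmu : (1 - X) * u⁻¹ = 1 + X := by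
    have h : (1 + X) * u = 1 - X := by
      rw [hu, ← mul_assoc, hcomm.eq, Matrix.mul_nonsing_inv_cancel_right _ _ hpdet]
    rw [← h, Matrix.mul_nonsing_inv_cancel_right _ _ hudet]
  have hunip : IsNilpotent (u - 1) := by
    have h : u - 1 = (-2 * (1 + X)⁻¹) * X := by
      apply hp.mul_left_injective
      have hX : X * (1 + X) = (1 + X) * X := by noncomm_ring
      change (u - 1) * (1 + X) = -2 * (1 + X)⁻¹ * X * (1 + X)
      rw [sub_mul, hup, mul_assoc, hX, mul_assoc, Matrix.nonsing_inv_mul_cancel_left _ _ hpdet]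
      noncomm_ring
    have hc : Commute (-2 * (1 + X)⁻¹) X := by
      refine Commute.mul_left ?_ ?_
      · exact (Commute.ofNat_left 2 X).neg_left
      · have h' : Commute (hp.unit : Matrix (Fin n) (Fin n) k) X :=
          (Commute.one_left X).add_left (Commute.refl X)
        simpa only [Matrix.coe_units_inv, IsUnit.unit_spec] using h'.units_inv_left
    rw [h]
    exact hc.isNilpotent_mul_left hXnil
  have hconj : ∀ Y ∈ isometryLieAlg k n J, u * Y * u⁻¹ ∈ isometryLieAlg k n J :=
    fun Y hY ↦ conj_mem_isometryLieAlg huu huJ hY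
  have had : ∀ Y ∈ isometryLieAlg k n J, X * Y - Y * X ∈ isometryLieAlg k n J :=
    fun Y hY ↦ commutator_mem_isometryLieAlg hXmem hY
  refine ⟨hp, huJ, huu, hunip, hconj, had, fun Y hY ↦ sub_mem (hconj Y hY) hY, ?_⟩
  let D₀ : Module.End k (Matrix (Fin n) (Fin n) k) :=
    LinearMap.mulLeft k X - LinearMap.mulRight k X
  let D : Module.End k (isometryLieAlg k n J) := D₀.restrict had
  let K₀ : Module.End k (Matrix (Fin n) (Fin n) k) :=
    LinearMap.mulLeft k (1 + X) * LinearMap.mulRight k (1 - X)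
  have hK₀ (Y) : K₀ Y = (1 + X) * (Y * (1 - X)) := rfl
  let K : Module.End k (isometryLieAlg k n J) := K₀.restrict (fun Y hY ↦ by
    have h : K₀ Y = Y + (X * Y - Y * X) - X * Y * X := by
      rw [hK₀]
      noncomm_ring
    rw [h]
    exact sub_mem (add_mem hY (had Y hY)) (mul_mul_mem_isometryLieAlg hXmem hY))
  have hK : IsUnit K := by
    rw [LinearMap.isUnit_iff_ker_eq_bot, LinearMap.ker_eq_bot]
    intro Y Z h
    apply Subtype.ext
    have h' : (1 + X) * ((Y : Matrix (Fin n) (Fin n) k) * (1 - X)) = (1 + X) * (Z * (1 - X)) :=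
      congrArg Subtype.val h
    exact hm.mul_left_injective (hp.mul_right_injective h')
  have hD : IsNilpotent D := by
    have h₀ : IsNilpotent D₀ :=
      (LinearMap.commute_mulLeft_right X X).isNilpotent_sub
        ((LinearMap.isNilpotent_mulLeft_iff k X).2 hXnil)
        ((LinearMap.isNilpotent_mulRight_iff k X).2 hXnil)
    obtain ⟨N, hN⟩ := h₀
    refine ⟨N, ?_⟩
    ext1 Y
    apply Subtype.ext
    rw [show D ^ N = _ from Module.End.pow_restrict N had, LinearMap.coe_restrict_apply, hN]
    rfl
  have hDK : Commute D K := by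
    ext1 Y
    apply Subtype.ext
    change X * ((1 + X) * ((Y : Matrix (Fin n) (Fin n) k) * (1 - X))) -
      (1 + X) * (Y * (1 - X)) * X = (1 + X) * ((X * Y - Y * X) * (1 - X))
    noncomm_ring
  obtain ⟨κ, hκ⟩ := hK
  have h2 : IsUnit (algebraMap k (Module.End k (isometryLieAlg k n J)) (-2)) :=
    (IsUnit.mk0 (-2 : k) (neg_ne_zero.2 hchar)).map _
  obtain ⟨g, hg⟩ := exists_linearEquiv_mul_eq_of_isNilpotent
    (C := algebraMap k _ (-2) * ((κ⁻¹ : (Module.End k (isometryLieAlg k n J))ˣ) :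
      Module.End k (isometryLieAlg k n J))) hD (h2.mul (Units.isUnit _))
    ((Algebra.commute_algebraMap_right (-2 : k) D).mul_right (Commute.units_inv_right (hκ ▸ hDK)))
  refine ⟨g, fun Y ↦ Eq.trans (congrArg g ?_) (hg Y)⟩
  obtain ⟨Z, rfl⟩ : ∃ Z, K Z = Y :=
    ⟨((κ⁻¹ : (Module.End k (isometryLieAlg k n J))ˣ) : Module.End k (isometryLieAlg k n J)) Y, by
      rw [← hκ, ← Module.End.mul_apply, Units.mul_inv, Module.End.one_apply]⟩
  have hZ : ((κ⁻¹ : (Module.End k (isometryLieAlg k n J))ˣ) :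
      Module.End k (isometryLieAlg k n J)) (K Z) = Z := by
    rw [← hκ, ← Module.End.mul_apply, Units.inv_mul, Module.End.one_apply]
  rw [Module.End.mul_apply, Module.End.mul_apply, hZ, Module.algebraMap_end_apply, map_smul]
  apply Subtype.ext
  change u * ((1 + X) * ((Z : Matrix (Fin n) (Fin n) k) * (1 - X))) * u⁻¹ -
    (1 + X) * (Z * (1 - X)) = (-2 : k) • (X * Z - Z * X)
  have h : u * ((1 + X) * ((Z : Matrix (Fin n) (Fin n) k) * (1 - X))) * u⁻¹ =
      (1 - X) * (Z * (1 + X)) := by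
    rw [← mul_assoc u, hup, mul_assoc, mul_assoc, hmu]
  rw [h, neg_smul, ofNat_smul_eq_nsmul, two_nsmul]
  noncomm_ring
end

section
/- Let F be a field of characteristic 0 and 𝔤 a finite-dimensional Lie algebra over F equipped with a grading: a direct sum decomposition 𝔤 = ⊕_{i∈ℤ} 𝔤(i) of vector spaces with [𝔤(i),𝔤(j)] ⊆ 𝔤(i+j), such that 𝔤(i) = 0 whenever i is odd, and 𝔤(i) = 0 whenever |i| > 2n for a fixed positive integer n. Let X ∈ 𝔤(2) be such that ad(X) : 𝔤(0) → 𝔤(2) is bijective and such that the centralizer c_𝔤(X) = { Y ∈ 𝔤 : [X,Y] = 0 } is contained in ⊕_{i ≥ 0} 𝔤(i). Let M ∈ 𝔤(−2n), set S = X + M, and let ρ : 𝔤 → 𝔫 := ⊕_{i>0} 𝔤(i) be the projection with kernel ⊕_{i≤0} 𝔤(i). Then the restriction of ρ to the centralizer c_𝔤(S) takes values in c_𝔤(X), and this restriction ρ|_{c_𝔤(S)} : c_𝔤(S) → c_𝔤(X) is injective. -/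
section GradedComponent

variable {F L : Type*} [Field F] [LieRing L] [LieAlgebra F L]
  (g : ℤ → Submodule F L) [DirectSum.Decomposition g]

/-- The projection onto the degree `k` piece of a graded Lie algebra, as an endomorphism. -/
noncomputable def gradedComponent (k : ℤ) : L →ₗ[F] L :=
  (g k).subtype ∘ₗ DirectSum.component F ℤ (fun i => g i) k ∘ₗ
    (DirectSum.decomposeLinearEquiv g).toLinearMap

theorem gradedComponent_mem (k : ℤ) (Y : L) : gradedComponent g k Y ∈ g k :=
  (DirectSum.decompose g Y k).2

theorem gradedComponent_of_mem {k : ℤ} {Y : L} (hY : Y ∈ g k) : gradedComponent g k Y = Y :=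
  DirectSum.decompose_of_mem_same g hY

theorem gradedComponent_of_mem_ne {i k : ℤ} {Y : L} (hY : Y ∈ g i) (h : i ≠ k) :
    gradedComponent g k Y = 0 :=
  DirectSum.decompose_of_mem_ne g hY h

theorem eq_zero_of_gradedComponent_eq_zero {Y : L} (h : ∀ k, gradedComponent g k Y = 0) :
    Y = 0 := by
  refine (DirectSum.decomposeLinearEquiv g).map_eq_zero_iff.mp (DFinsupp.ext fun k => ?_)
  exact Subtype.ext (h k)

theorem gradedComponent_lie (hbr : ∀ i j : ℤ, ∀ x ∈ g i, ∀ y ∈ g j, ⁅x, y⁆ ∈ g (i + j))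
    {d : ℤ} {A : L} (hA : A ∈ g d) (k : ℤ) (Y : L) :
    gradedComponent g k ⁅A, Y⁆ = ⁅A, gradedComponent g (k - d) Y⁆ := by
  induction Y using DirectSum.Decomposition.inductionOn g with
  | zero => simp
  | @homogeneous i y =>
    have hAy := hbr d i A hA y y.2
    by_cases h : i = k - d
    · subst h
      rw [gradedComponent_of_mem g y.2]
      rw [add_sub_cancel] at hAy
      exact gradedComponent_of_mem g hAy
    · rw [gradedComponent_of_mem_ne g y.2 h, lie_zero]
      exact gradedComponent_of_mem_ne g hAy (by omega)
  | add y z hy hz => simp [hy, hz]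

theorem gradedComponent_projection {ρ : L →ₗ[F] L}
    (hρpos : ∀ i : ℤ, 0 < i → ∀ x ∈ g i, ρ x = x)
    (hρnonpos : ∀ i : ℤ, i ≤ 0 → ∀ x ∈ g i, ρ x = 0) (k : ℤ) (Y : L) :
    gradedComponent g k (ρ Y) = if 0 < k then gradedComponent g k Y else 0 := by
  induction Y using DirectSum.Decomposition.inductionOn g with
  | zero => simp
  | @homogeneous i y =>
    rcases lt_or_ge 0 i with hi | hi
    · rw [hρpos i hi y y.2]
      split_ifs with hk
      · rfl
      · exact gradedComponent_of_mem_ne g y.2 (by omega)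
    · rw [hρnonpos i hi y y.2, map_zero]
      split_ifs with hk
      · exact (gradedComponent_of_mem_ne g y.2 (by omega)).symm
      · rfl
  | add y z hy hz =>
    rw [map_add, map_add, hy, hz]
    split_ifs <;> simp

theorem gradedComponent_of_mem_iSup_nonneg {Y : L} (hY : Y ∈ ⨆ i ∈ Set.Ici (0 : ℤ), g i)
    {k : ℤ} (hk : k < 0) : gradedComponent g k Y = 0 := by
  have h : ⨆ i ∈ Set.Ici (0 : ℤ), g i ≤ LinearMap.ker (gradedComponent g k) :=
    iSup₂_le fun i hi y hy =>
      gradedComponent_of_mem_ne g hy (hk.trans_le (Set.mem_Ici.mp hi)).ne'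
  exact h hY

end GradedComponent

/-- Let `F` be a field of characteristic `0` and `𝔤` a
finite-dimensional Lie algebra over `F` with a `ℤ`-grading `𝔤 = ⊕ᵢ 𝔤(i)` (internal
direct sum of subspaces with `[𝔤(i),𝔤(j)] ⊆ 𝔤(i+j)`), all odd pieces vanishing, and
`𝔤(i) = 0` for `|i| > 2n` (`n > 0`).  Let `X ∈ 𝔤(2)` be such that
`ad(X) : 𝔤(0) → 𝔤(2)` is bijective and the centralizer of `X` lies in `⊕_{i≥0} 𝔤(i)`.
Let `M ∈ 𝔤(−2n)`, `S = X + M`, and let `ρ` be the projection onto `𝔫 = ⊕_{i>0} 𝔤(i)`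
killing `⊕_{i≤0} 𝔤(i)`.  Then `ρ` maps the centralizer of `S` into the centralizer of
`X`, injectively. -/
theorem stmt12 (F : Type*) [Field F] [CharZero F]
    (L : Type*) [LieRing L] [LieAlgebra F L] [Module.Finite F L]
    (g : ℤ → Submodule F L)
    (hdecomp : DirectSum.IsInternal g)
    (hbr : ∀ i j : ℤ, ∀ x ∈ g i, ∀ y ∈ g j, ⁅x, y⁆ ∈ g (i + j))
    (hodd : ∀ i : ℤ, Odd i → g i = ⊥)
    (n : ℕ) (hn : 0 < n)
    (hbound : ∀ i : ℤ, (2 * n : ℤ) < |i| → g i = ⊥)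
    (X : L) (hX : X ∈ g 2)
    (hadinj : ∀ x ∈ g 0, ⁅X, x⁆ = 0 → x = 0)
    (hadsurj : ∀ y ∈ g 2, ∃ x ∈ g 0, ⁅X, x⁆ = y)
    (hcent : ∀ Y : L, ⁅X, Y⁆ = 0 → Y ∈ ⨆ i ∈ Set.Ici (0 : ℤ), g i)
    (M : L) (hM : M ∈ g (-(2 * n : ℤ)))
    (S : L) (hS : S = X + M)
    (ρ : L →ₗ[F] L)
    (hρpos : ∀ i : ℤ, 0 < i → ∀ x ∈ g i, ρ x = x)
    (hρnonpos : ∀ i : ℤ, i ≤ 0 → ∀ x ∈ g i, ρ x = 0) :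
    (∀ Y : L, ⁅S, Y⁆ = 0 → ⁅X, ρ Y⁆ = 0) ∧
    (∀ Y Z : L, ⁅S, Y⁆ = 0 → ⁅S, Z⁆ = 0 → ρ Y = ρ Z → Y = Z) := by
  let _ := hdecomp.chooseDecomposition
  have comp_bound : ∀ (k : ℤ) (Y : L), (2 * n : ℤ) < |k| → gradedComponent g k Y = 0 := by
    intro k Y hk
    have h := gradedComponent_mem g k Y
    rwa [hbound k hk, Submodule.mem_bot] at h
  have comp_eq : ∀ Y : L, ⁅S, Y⁆ = 0 → ∀ j : ℤ,
      ⁅X, gradedComponent g j Y⁆ + ⁅M, gradedComponent g (j + 2 + 2 * n) Y⁆ = 0 := by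
    intro Y hY j
    have h := congrArg (gradedComponent g (j + 2)) hY
    rwa [hS, add_lie, map_add, gradedComponent_lie g hbr hX, gradedComponent_lie g hbr hM,
      map_zero, add_sub_cancel_right, sub_neg_eq_add] at h
  have lie_comp : ∀ Y : L, ⁅S, Y⁆ = 0 → ∀ j : ℤ, 0 ≤ j → ⁅X, gradedComponent g j Y⁆ = 0 := by
    intro Y hY j hj
    have h := comp_eq Y hY j
    rwa [comp_bound (j + 2 + 2 * n) Y (lt_abs.mpr (Or.inl (by omega))), lie_zero,
      add_zero] at h
  constructor
  · intro Y hY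
    refine eq_zero_of_gradedComponent_eq_zero g fun k => ?_
    rw [gradedComponent_lie g hbr hX, gradedComponent_projection g hρpos hρnonpos]
    split_ifs with hk
    · exact lie_comp Y hY _ hk.le
    · exact lie_zero X
  · intro Y Z hY hZ hYZ
    rw [← sub_eq_zero]
    have hW : ⁅S, Y - Z⁆ = 0 := by rw [lie_sub, hY, hZ, sub_zero]
    have hρ : ρ (Y - Z) = 0 := by rw [map_sub, hYZ, sub_self]
    generalize Y - Z = W at hW hρ ⊢
    have comp_pos : ∀ k : ℤ, 0 < k → gradedComponent g k W = 0 := by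
      intro k hk
      have h := gradedComponent_projection g hρpos hρnonpos k W
      rwa [hρ, map_zero, if_pos hk, eq_comm] at h
    refine eq_zero_of_gradedComponent_eq_zero g fun k => ?_
    rcases lt_trichotomy k 0 with hk | rfl | hk
    · by_cases hkn : k < -(2 * n : ℤ)
      · exact comp_bound k W (lt_abs.mpr (Or.inr (by omega)))
      · have h := comp_eq W hW k
        rw [comp_pos (k + 2 + 2 * n) (by omega), lie_zero, add_zero] at h
        have h0 := gradedComponent_of_mem_iSup_nonneg g (hcent _ h) hk
        rwa [gradedComponent_of_mem g (gradedComponent_mem g k W)] at h0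
    · exact hadinj _ (gradedComponent_mem g 0 W) (lie_comp W hW 0 le_rfl)
    · exact comp_pos k hk
end
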